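/- (Theorem 2, diminishing-returns inequality for dynamic diminishing attention.) Let g₁, g₂ : ℝ → ℝ be concave on [0,∞) with g₁ having uniformly smaller increments than g₂, i.e. g₁(x + α) − g₁(x) ≤ g₂(x + α) − g₂(x) for all x ≥ 0 and α ≥ 0. Let 0 ≤ c_s ≤ c_t be coverages at two decoding steps s ≤ t and let P_s, P_t ∈ [0,1] be the corresponding weights with P_s ≤ P_t. Then for every attention score α ≥ 0, the dynamic diminishing attention gain at the later step is at most that at the earlier step: P_t·(g₁(c_t + α) − g₁(c_t)) + (1 − P_t)·(g₂(c_t + α) − g₂(c_t)) ≤ P_s·(g₁(c_s + α) − g₁(c_s)) + (1 − P_s)·(g₂(c_s + α) − g₂(c_s)). Consequently the effective coverage of dynamic diminishing attention, the running sum of these gains, has the diminishing-returns (submodularity) property. -/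

import Mathlib

/-- The increments of a concave function on `[0,∞)` are antitone in the base point. -/
theorem ConcaveOn.increment_le_increment {g : ℝ → ℝ} (hg : ConcaveOn ℝ (Set.Ici (0 : ℝ)) g)
    {x y α : ℝ} (hx : 0 ≤ x) (hxy : x ≤ y) (hα : 0 ≤ α) :
    g (y + α) - g y ≤ g (x + α) - g x := by
  rcases hα.eq_or_lt with rfl | hα'
  · simp
  have hd : 0 < y - x + α := by linarith
  have hx' : x ∈ Set.Ici (0 : ℝ) := hx
  have hy' : y + α ∈ Set.Ici (0 : ℝ) := by
    simp only [Set.mem_Ici]; linarith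
  have ha : 0 ≤ (y - x) / (y - x + α) := div_nonneg (by linarith) hd.le
  have hb : 0 ≤ α / (y - x + α) := div_nonneg hα hd.le
  have hab : (y - x) / (y - x + α) + α / (y - x + α) = 1 := by
    rw [← add_div, div_self hd.ne']
  have h₁ := hg.2 hx' hy' ha hb hab
  have h₂ := hg.2 hx' hy' hb ha (by rw [add_comm, hab])
  have e₁ : (y - x) / (y - x + α) * x + α / (y - x + α) * (y + α) = x + α := by
    field_simp; ring
  have e₂ : α / (y - x + α) * x + (y - x) / (y - x + α) * (y + α) = y := by
    field_simp; ring
  simp only [smul_eq_mul, e₁, e₂] at h₁ h₂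
  linear_combination h₁ + h₂ - (g x + g (y + α)) * hab

/-- Theorem 2, diminishing returns for dynamic diminishing
attention: let `g₁ g₂` be concave on `[0,∞)` with `g₁` having uniformly
smaller increments than `g₂`; let `0 ≤ cs ≤ ct` be coverages at steps
`s ≤ t` and `Ps ≤ Pt` in `[0,1]` the corresponding weights. Then for every
attention score `α ≥ 0`, the dynamic diminishing attention gain at the later
step is at most that at the earlier step. -/
theorem dynamic_diminishing_attention_diminishing_returns
    (g₁ g₂ : ℝ → ℝ)
    (hg₁ : ConcaveOn ℝ (Set.Ici (0 : ℝ)) g₁)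
    (hg₂ : ConcaveOn ℝ (Set.Ici (0 : ℝ)) g₂)
    (hinc : ∀ x α : ℝ, 0 ≤ x → 0 ≤ α →
      g₁ (x + α) - g₁ x ≤ g₂ (x + α) - g₂ x)
    (cs ct : ℝ) (hcs : 0 ≤ cs) (hcst : cs ≤ ct)
    (Ps Pt : ℝ) (hPs0 : 0 ≤ Ps) (hPt1 : Pt ≤ 1) (hPs1 : Ps ≤ 1)
    (hPt0 : 0 ≤ Pt) (hPst : Ps ≤ Pt)
    (α : ℝ) (hα : 0 ≤ α) :
    Pt * (g₁ (ct + α) - g₁ ct) + (1 - Pt) * (g₂ (ct + α) - g₂ ct) ≤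
      Ps * (g₁ (cs + α) - g₁ cs) + (1 - Ps) * (g₂ (cs + α) - g₂ cs) := by
  have h₁ := hg₁.increment_le_increment hcs hcst hα
  have h₂ := hg₂.increment_le_increment hcs hcst hα
  have h₃ := hinc cs α hcs hα
  linear_combination Pt * h₁ + (1 - Pt) * h₂ + (Pt - Ps) * h₃
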